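/- Under Assumptions 1 and 2, defining C^{(j)} = (4π)⁻¹ ∑_{ℓ≥0} (2ℓ+1) b_{j,ℓ}² C_ℓ, there exist constants c₁, c₂ > 0 and j₀ ∈ ℕ such that c₁ B^{j(2−α)} ≤ C^{(j)} ≤ c₂ B^{j(2−α)} for all j ≥ j₀ (the upper bound holding for all j ∈ ℕ). -/

import Mathlib

open MeasureTheory Real Filter Asymptotics ProbabilityTheory
open scoped BigOperators ENNReal NNReal RealInnerProductSpace Classical

noncomputable section

/-- Euclidean space `ℝ³`. -/
abbrev E3 : Type := EuclideanSpace ℝ (Fin 3)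

/-- Geodesic distance on the unit sphere `S² ⊆ ℝ³`. -/
noncomputable def gd (x y : E3) : ℝ := Real.arccos ⟪x, y⟫

/-- Legendre polynomial of degree `l` (Rodrigues' formula). -/
noncomputable def legP (l : ℕ) (x : ℝ) : ℝ :=
  ((2 : ℝ) ^ l * (Nat.factorial l : ℝ))⁻¹ *
    iteratedDeriv l (fun t : ℝ => (t ^ 2 - 1) ^ l) x

/-- Normalized Legendre kernel `L_ℓ = ((2ℓ+1)/(4π)) P_ℓ`. -/
noncomputable def legL (l : ℕ) (x : ℝ) : ℝ := ((2 * l + 1) / (4 * Real.pi)) * legP l x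

/-- `μ` is the rotation-invariant surface measure on `S²` with total mass `4π`. -/
def IsSphereMeasure (μ : MeasureTheory.Measure E3) : Prop :=
  (∀ ρ : E3 ≃ₗᵢ[ℝ] E3, μ.map ρ = μ) ∧
    μ (Metric.sphere (0 : E3) 1)ᶜ = 0 ∧ μ Set.univ = ENNReal.ofReal (4 * Real.pi)

/-- A pixelization of order `L` with constant `c₀`: cubature points `ξ` on the sphere and
positive weights `w` satisfying properties (1a)–(1e). -/
structure IsPixelization (μ : MeasureTheory.Measure E3) (c₀ L : ℝ) {N : ℕ}
    (ξ : Fin N → E3) (w : Fin N → ℝ) : Prop where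
  sphere : ∀ k, ‖ξ k‖ = 1
  wpos : ∀ k, 0 < w k
  cubature : ∀ p : MvPolynomial (Fin 3) ℝ, (p.totalDegree : ℝ) ≤ L →
    ∑ k, w k * MvPolynomial.eval (fun i => ξ k i) p
      = ∫ x, MvPolynomial.eval (fun i => x i) p ∂μ
  card_low : c₀⁻¹ * L ^ 2 ≤ (N : ℝ)
  card_high : (N : ℝ) ≤ c₀ * L ^ 2
  w_low : ∀ k, c₀⁻¹ * (L ^ 2)⁻¹ ≤ w k
  w_high : ∀ k, w k ≤ c₀ * (L ^ 2)⁻¹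
  covering : ∀ x : E3, ‖x‖ = 1 → ∃ k, gd x (ξ k) ≤ c₀ * L⁻¹
  separation : ∀ k k' : Fin N, k ≠ k' → c₀⁻¹ * L⁻¹ ≤ gd (ξ k) (ξ k')

/-- Assumption 1: the function `a` generating the `B`-adic window. -/
structure IsWindow (B : ℝ) (M : ℕ) (a : ℝ → ℝ) : Prop where
  oneLt : 1 < B
  Mge : 3 ≤ M
  smooth : ContDiff ℝ M a
  suppB : ∀ x : ℝ, B < |x| → a x = 0
  oneOn : ∀ x : ℝ, |x| ≤ B⁻¹ → a x = 1

/-- `b(x) = a(x/B) − a(x)`. -/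
noncomputable def bW (B : ℝ) (a : ℝ → ℝ) (x : ℝ) : ℝ := a (x / B) - a x

/-- `b_{j,ℓ} = b(B^{−j} ℓ)`. -/
noncomputable def bjl (B : ℝ) (a : ℝ → ℝ) (j l : ℕ) : ℝ := bW B a ((l : ℝ) / B ^ j)

/-- The needlet kernel `Ψ_j(t) = ∑_ℓ b_{j,ℓ} L_ℓ(t)`. -/
noncomputable def psiSum (B : ℝ) (a : ℝ → ℝ) (j : ℕ) (t : ℝ) : ℝ :=
  ∑' l : ℕ, bjl B a j l * legL l t

/-- The band-averaged power spectrum `C^{(j)} = (4π)⁻¹ ∑_ℓ (2ℓ+1) b_{j,ℓ}² C_ℓ`. -/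
noncomputable def Cband (B : ℝ) (a : ℝ → ℝ) (C : ℕ → ℝ) (j : ℕ) : ℝ :=
  (4 * Real.pi)⁻¹ * ∑' l : ℕ, (2 * l + 1) * (bjl B a j l) ^ 2 * C l

/-- Assumption 2: regularity of the power spectrum `C_ℓ = ℓ^{−α} g_j(B^{−j}ℓ)`. -/
structure IsSpectrum (B : ℝ) (M : ℕ) (α : ℝ) (C : ℕ → ℝ) (g : ℕ → ℝ → ℝ) (d : ℕ → ℝ) :
    Prop where
  alpha_gt : 2 < α
  nonneg : ∀ l, 0 ≤ C l
  smooth : ∀ j, ContDiff ℝ M (g j)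
  eq : ∀ j l : ℕ, B ^ j / B ≤ (l : ℝ) → (l : ℝ) ≤ B ^ j * B →
    C l = (l : ℝ) ^ (-α) * g j ((l : ℝ) / B ^ j)
  dpos : ∀ r, r ≤ M → 0 < d r
  g_low : ∀ j, ∀ u ∈ Set.Icc B⁻¹ B, (d 0)⁻¹ ≤ g j u
  g_high : ∀ j, ∀ u ∈ Set.Icc B⁻¹ B, g j u ≤ d 0
  deriv_bound : ∀ j r, 1 ≤ r → r ≤ M → ∀ u ∈ Set.Icc B⁻¹ B,
    |iteratedDeriv r (g j) u| ≤ d r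

/-- The spectrum obeys `C_ℓ ≍ ℓ^{−α}` at every positive frequency. -/
theorem IsSpectrum.two_sided {B : ℝ} {M : ℕ} {α : ℝ} {C : ℕ → ℝ} {g : ℕ → ℝ → ℝ} {d : ℕ → ℝ}
    (h : IsSpectrum B M α C g d) (hB : 1 < B) {l : ℕ} (hl : 1 ≤ l) :
    (l : ℝ) ^ (-α) * (d 0)⁻¹ ≤ C l ∧ C l ≤ (l : ℝ) ^ (-α) * d 0 := by
  obtain ⟨j, hj₁, hj₂⟩ := exists_nat_pow_near (x := (l : ℝ)) (by exact_mod_cast hl) hB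
  have hX : 0 < B ^ j := by positivity
  have hlow : B ^ j / B ≤ (l : ℝ) := (div_le_self hX.le hB.le).trans hj₁
  have hhigh : (l : ℝ) ≤ B ^ j * B := by rw [← pow_succ]; exact hj₂.le
  have hmem : (l : ℝ) / B ^ j ∈ Set.Icc B⁻¹ B := by
    constructor
    · rw [le_div_iff₀ hX, inv_mul_eq_div]; exact hlow
    · rw [div_le_iff₀ hX, mul_comm]; exact hhigh
  have hpow : 0 ≤ (l : ℝ) ^ (-α) := by positivity
  rw [h.eq j l hlow hhigh]
  exact ⟨mul_le_mul_of_nonneg_left (h.g_low j _ hmem) hpow,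
    mul_le_mul_of_nonneg_left (h.g_high j _ hmem) hpow⟩

theorem IsWindow.continuous_bW {B : ℝ} {M : ℕ} {a : ℝ → ℝ} (h : IsWindow B M a) :
    Continuous (bW B a) := by
  have ha := h.smooth.continuous
  unfold bW
  fun_prop

theorem IsWindow.bW_eq_zero_of_le {B : ℝ} {M : ℕ} {a : ℝ → ℝ} (h : IsWindow B M a) {x : ℝ}
    (hx₀ : 0 ≤ x) (hx : x ≤ B⁻¹) : bW B a x = 0 := by
  have hB := h.oneLt
  have hdiv : x / B ≤ x := div_le_self hx₀ hB.le
  have hdiv₀ : 0 ≤ x / B := by positivity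
  unfold bW
  rw [h.oneOn x (by rwa [abs_of_nonneg hx₀]),
    h.oneOn (x / B) (by rw [abs_of_nonneg hdiv₀]; exact hdiv.trans hx), sub_self]

theorem IsWindow.bW_eq_zero_of_lt {B : ℝ} {M : ℕ} {a : ℝ → ℝ} (h : IsWindow B M a) {x : ℝ}
    (hx : B ^ 2 < x) : bW B a x = 0 := by
  have hB := h.oneLt
  have hBx : B < x := by nlinarith
  have hdiv : B < x / B := by rw [lt_div_iff₀ (by linarith)]; nlinarith
  unfold bW
  rw [h.suppB x (hBx.trans_le (le_abs_self x)), h.suppB _ (hdiv.trans_le (le_abs_self _)),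
    sub_self]

theorem IsWindow.exists_abs_bW_le {B : ℝ} {M : ℕ} {a : ℝ → ℝ} (h : IsWindow B M a) :
    ∃ K : ℝ, 0 < K ∧ ∀ x, 0 ≤ x → |bW B a x| ≤ K := by
  obtain ⟨K, hK⟩ := (isCompact_Icc (a := (0 : ℝ)) (b := B ^ 2)).exists_bound_of_continuousOn
    h.continuous_bW.continuousOn
  refine ⟨max K 1, by positivity, fun x hx => ?_⟩
  rcases le_or_gt x (B ^ 2) with hx' | hx'
  · exact (hK x ⟨hx, hx'⟩).trans (le_max_left _ _)
  · rw [h.bW_eq_zero_of_lt hx', abs_zero]; positivity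

/-- The window function is bounded away from zero on some nondegenerate interval. -/
theorem IsWindow.exists_le_abs_bW {B : ℝ} {M : ℕ} {a : ℝ → ℝ} (h : IsWindow B M a) :
    ∃ p q ε : ℝ, 0 < p ∧ p < q ∧ 0 < ε ∧ ∀ x, p ≤ x → x ≤ q → ε ≤ |bW B a x| := by
  have hB := h.oneLt
  have hB₀ : 0 < B := by linarith
  obtain ⟨x₀, hx₀, hne⟩ : ∃ x, 0 < x ∧ bW B a x ≠ 0 := by
    by_contra! hzero
    have h₀ := hzero 1 one_pos
    have h₁ := hzero B hB₀
    have h₂ := hzero (B * B) (by positivity)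
    have hBB : B < |B * B| := by rw [abs_of_pos (by positivity)]; nlinarith
    unfold bW at h₀ h₁ h₂
    rw [one_div, h.oneOn B⁻¹ (abs_of_pos (by positivity)).le] at h₀
    rw [div_self hB₀.ne'] at h₁
    rw [mul_div_cancel_right₀ _ hB₀.ne', h.suppB _ hBB] at h₂
    linarith
  have hpos : 0 < |bW B a x₀| := abs_pos.mpr hne
  have hev : ∀ᶠ x in nhds x₀, |bW B a x₀| / 2 < |bW B a x| :=
    h.continuous_bW.abs.continuousAt.eventually (lt_mem_nhds (half_lt_self hpos))
  obtain ⟨δ, hδ, hball⟩ := Metric.eventually_nhds_iff.mp hev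
  refine ⟨x₀, x₀ + δ / 2, |bW B a x₀| / 2, hx₀, by linarith, by positivity,
    fun x hx₁ hx₂ => (hball ?_).le⟩
  rw [Real.dist_eq, abs_of_nonneg (by linarith)]
  linarith

theorem IsWindow.bjl_eq_zero_of_notMem {B : ℝ} {M : ℕ} {a : ℝ → ℝ} (h : IsWindow B M a)
    {j l : ℕ} (hl : l ∉ Finset.Icc 1 ⌊B ^ 2 * B ^ j⌋₊) : bjl B a j l = 0 := by
  have hB := h.oneLt
  have hX : 0 < B ^ j := by positivity
  rcases Nat.eq_zero_or_pos l with rfl | hpos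
  · exact h.bW_eq_zero_of_le (by simp) (by simp; linarith)
  · rw [Finset.mem_Icc, not_and, not_le] at hl
    refine h.bW_eq_zero_of_lt ?_
    rw [lt_div_iff₀ hX]
    exact (Nat.floor_lt (by positivity)).mp (hl hpos)

theorem IsWindow.Cband_le {B : ℝ} {M : ℕ} {a : ℝ → ℝ} (hwin : IsWindow B M a)
    {α : ℝ} {C : ℕ → ℝ} {g : ℕ → ℝ → ℝ} {d : ℕ → ℝ} (hspec : IsSpectrum B M α C g d) :
    ∃ c : ℝ, 0 < c ∧ ∀ j : ℕ, Cband B a C j ≤ c * B ^ ((j : ℝ) * (2 - α)) := by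
  have hB := hwin.oneLt
  have hα := hspec.alpha_gt
  have hd : 0 < d 0 := hspec.dpos 0 (Nat.zero_le _)
  obtain ⟨K, hK, hbK⟩ := hwin.exists_abs_bW_le
  refine ⟨(4 * π)⁻¹ * (B ^ 2 * (3 * K ^ 2 * d 0 * B⁻¹ ^ (1 - α))), by positivity, fun j => ?_⟩
  have hX : 0 < B ^ j := by positivity
  have hterm : ∀ l ∈ Finset.Icc 1 ⌊B ^ 2 * B ^ j⌋₊, (2 * (l : ℝ) + 1) * bjl B a j l ^ 2 * C l
      ≤ 3 * K ^ 2 * d 0 * (B⁻¹ * B ^ j) ^ (1 - α) := by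
    intro l hl
    have hl₁ : 1 ≤ l := (Finset.mem_Icc.mp hl).1
    have hl₁' : (1 : ℝ) ≤ l := by exact_mod_cast hl₁
    rcases le_or_gt ((l : ℝ) / B ^ j) B⁻¹ with hle | hgt
    · have hz : bjl B a j l = 0 := hwin.bW_eq_zero_of_le (by positivity) hle
      rw [hz, zero_pow two_ne_zero, mul_zero, zero_mul]
      positivity
    · rw [lt_div_iff₀ hX] at hgt
      have hsq : bjl B a j l ^ 2 ≤ K ^ 2 := by
        rw [← sq_abs]
        exact pow_le_pow_left₀ (abs_nonneg _) (hbK _ (by positivity)) 2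
      calc (2 * (l : ℝ) + 1) * bjl B a j l ^ 2 * C l
          ≤ (3 * l) * K ^ 2 * ((l : ℝ) ^ (-α) * d 0) := by
            gcongr
            · exact hspec.nonneg l
            · linarith
            · exact (hspec.two_sided hB hl₁).2
        _ = 3 * K ^ 2 * d 0 * (l : ℝ) ^ (1 - α) := by
            rw [sub_eq_add_neg, Real.rpow_add (by positivity), Real.rpow_one]; ring
        _ ≤ _ := mul_le_mul_of_nonneg_left
            (Real.rpow_le_rpow_of_nonpos (by positivity) hgt.le (by linarith)) (by positivity)
  have hsum := Finset.sum_le_card_nsmul _ _ _ hterm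
  rw [nsmul_eq_mul, Nat.card_Icc, Nat.add_sub_cancel] at hsum
  rw [Cband, tsum_eq_sum (s := Finset.Icc 1 ⌊B ^ 2 * B ^ j⌋₊) fun l hl => by
    rw [hwin.bjl_eq_zero_of_notMem hl, zero_pow two_ne_zero, mul_zero, zero_mul]]
  calc _ ≤ (4 * π)⁻¹ * (B ^ 2 * B ^ j * (3 * K ^ 2 * d 0 * (B⁻¹ * B ^ j) ^ (1 - α))) := by
        refine mul_le_mul_of_nonneg_left (hsum.trans ?_) (by positivity)
        exact mul_le_mul_of_nonneg_right (Nat.floor_le (by positivity)) (by positivity)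
    _ = _ := by
        rw [Real.mul_rpow (by positivity) hX.le, Real.rpow_mul (by positivity),
          Real.rpow_natCast, show (2 : ℝ) - α = 1 + (1 - α) by ring, Real.rpow_add hX,
          Real.rpow_one]
        ring

theorem IsWindow.le_Cband {B : ℝ} {M : ℕ} {a : ℝ → ℝ} (hwin : IsWindow B M a)
    {α : ℝ} {C : ℕ → ℝ} {g : ℕ → ℝ → ℝ} {d : ℕ → ℝ} (hspec : IsSpectrum B M α C g d) :
    ∃ c : ℝ, 0 < c ∧ ∃ j₀ : ℕ, ∀ j : ℕ, j₀ ≤ j →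
      c * B ^ ((j : ℝ) * (2 - α)) ≤ Cband B a C j := by
  have hB := hwin.oneLt
  have hα := hspec.alpha_gt
  have hd : 0 < d 0 := hspec.dpos 0 (Nat.zero_le _)
  obtain ⟨p, q, ε, hp, hpq, hε, hb⟩ := hwin.exists_le_abs_bW
  have hq : 0 < q := hp.trans hpq
  have hqp : 0 < q - p := sub_pos.mpr hpq
  obtain ⟨j₀, hj₀⟩ := pow_unbounded_of_one_lt (2 / (q - p)) hB
  refine ⟨(4 * π)⁻¹ * ((q - p) / 2 * (2 * ε ^ 2 * (d 0)⁻¹ * q ^ (1 - α))), by positivity, j₀,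
    fun j hj => ?_⟩
  have hX : 0 < B ^ j := by positivity
  have hlarge : 2 < B ^ j * (q - p) := by
    rw [← div_lt_iff₀ hqp]
    exact hj₀.trans_le (pow_le_pow_right₀ hB.le hj)
  have hterm : ∀ l ∈ Finset.Icc ⌈p * B ^ j⌉₊ ⌊q * B ^ j⌋₊,
      2 * ε ^ 2 * (d 0)⁻¹ * (q * B ^ j) ^ (1 - α)
        ≤ (2 * (l : ℝ) + 1) * bjl B a j l ^ 2 * C l := by
    intro l hl
    rw [Finset.mem_Icc, Nat.ceil_le, Nat.le_floor_iff (by positivity)] at hl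
    obtain ⟨hpl, hlq⟩ := hl
    have hl₀ : (0 : ℝ) < l := lt_of_lt_of_le (by positivity) hpl
    have hl₁ : 1 ≤ l := by exact_mod_cast hl₀
    have hsq : ε ^ 2 ≤ bjl B a j l ^ 2 := by
      rw [← sq_abs (bjl B a j l)]
      exact pow_le_pow_left₀ hε.le
        (hb _ ((le_div_iff₀ hX).mpr hpl) ((div_le_iff₀ hX).mpr hlq)) 2
    calc _ ≤ 2 * ε ^ 2 * (d 0)⁻¹ * (l : ℝ) ^ (1 - α) := mul_le_mul_of_nonneg_left
            (Real.rpow_le_rpow_of_nonpos hl₀ hlq (by linarith)) (by positivity)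
      _ = (2 * l) * ε ^ 2 * ((l : ℝ) ^ (-α) * (d 0)⁻¹) := by
            rw [sub_eq_add_neg, Real.rpow_add hl₀, Real.rpow_one]; ring
      _ ≤ _ := by
            gcongr
            · linarith
            · exact (hspec.two_sided hB hl₁).1
  have hsum := Finset.card_nsmul_le_sum _ _ _ hterm
  rw [nsmul_eq_mul, Nat.card_Icc] at hsum
  have hcard : (q - p) / 2 * B ^ j ≤ ((⌊q * B ^ j⌋₊ + 1 - ⌈p * B ^ j⌉₊ : ℕ) : ℝ) := by
    have h₁ := Nat.lt_floor_add_one (q * B ^ j)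
    have h₂ := Nat.ceil_lt_add_one (a := p * B ^ j) (by positivity)
    have h₃ : ((⌊q * B ^ j⌋₊ + 1 : ℕ) : ℝ)
        ≤ ((⌊q * B ^ j⌋₊ + 1 - ⌈p * B ^ j⌉₊ : ℕ) : ℝ) + (⌈p * B ^ j⌉₊ : ℝ) := by
      exact_mod_cast le_tsub_add
    push_cast at h₃
    linarith
  have hsummable : Summable fun l : ℕ => (2 * (l : ℝ) + 1) * bjl B a j l ^ 2 * C l :=
    summable_of_ne_finset_zero (s := Finset.Icc 1 ⌊B ^ 2 * B ^ j⌋₊) fun l hl => by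
      rw [hwin.bjl_eq_zero_of_notMem hl, zero_pow two_ne_zero, mul_zero, zero_mul]
  have htsum := hsummable.sum_le_tsum (Finset.Icc ⌈p * B ^ j⌉₊ ⌊q * B ^ j⌋₊) fun l _ =>
    mul_nonneg (by positivity) (hspec.nonneg l)
  calc _ = (4 * π)⁻¹ * ((q - p) / 2 * B ^ j *
          (2 * ε ^ 2 * (d 0)⁻¹ * (q * B ^ j) ^ (1 - α))) := by
        rw [Real.mul_rpow hq.le hX.le, Real.rpow_mul (by positivity),
          Real.rpow_natCast, show (2 : ℝ) - α = 1 + (1 - α) by ring, Real.rpow_add hX,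
          Real.rpow_one]
        ring
    _ ≤ _ := mul_le_mul_of_nonneg_left
        ((mul_le_mul_of_nonneg_right hcard (by positivity)).trans (hsum.trans htsum))
        (by positivity)

/-- `C^{(j)} ≍ B^{j(2−α)}` under Assumptions 1 and 2. -/
theorem stmt_6 (B : ℝ) (M : ℕ) (a : ℝ → ℝ) (hwin : IsWindow B M a)
    (α : ℝ) (C : ℕ → ℝ) (g : ℕ → ℝ → ℝ) (d : ℕ → ℝ)
    (hspec : IsSpectrum B M α C g d) :
    ∃ c₁ c₂ : ℝ, 0 < c₁ ∧ 0 < c₂ ∧ ∃ j₀ : ℕ,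
      (∀ j : ℕ, j₀ ≤ j → c₁ * B ^ ((j : ℝ) * (2 - α)) ≤ Cband B a C j) ∧
      ∀ j : ℕ, Cband B a C j ≤ c₂ * B ^ ((j : ℝ) * (2 - α)) := by
  obtain ⟨c₁, hc₁, j₀, hlow⟩ := hwin.le_Cband hspec
  obtain ⟨c₂, hc₂, hhigh⟩ := hwin.Cband_le hspec
  exact ⟨c₁, c₂, hc₁, hc₂, j₀, hlow, hhigh⟩
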